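/- arXiv:2109.14391 — 4 statements merged into one kernel-verified Lean document; each statement's English description precedes it below -/
import Mathlib

section
/- Let S_a and S_b be simple weighted transition systems over the same finite output set Y ⊆ ℚ with B^ω(S_a) ⊆ B^ω(S_b) (in particular, this holds if S_b simulates S_a). Suppose there exists a cycle x_0…x_k of S_b whose output word c := H_b(x_0)…H_b(x_k) satisfies LimAvg(c^ω) = VS(S_b), and a finite word d over Y such that the infinite word d c^ω belongs to B^ω(S_a). Then VS(S_a) = VS(S_b). -/
structure TS (X : Type*) where
  init : Set X
  E : Set (X × X)
  H : X → ℚ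

variable {X : Type*}

def TS.IsRun (S : TS X) (r : ℕ → X) : Prop :=
  r 0 ∈ S.init ∧ ∀ i, (r i, r (i + 1)) ∈ S.E

def TS.Beh (S : TS X) : Set (ℕ → ℚ) :=
  {b | ∃ r : ℕ → X, S.IsRun r ∧ b = fun i => S.H (r i)}

noncomputable def LimAvg (v : ℕ → ℚ) : ℝ :=
  Filter.atTop.liminf fun n => (∑ i ∈ Finset.range (n + 1), (v i : ℝ)) / (n + 1)

noncomputable def TS.VS (S : TS X) : ℝ := sInf (LimAvg '' S.Beh)

/-- The infinite periodic repetition `c^ω` of a finite word `c` of length `p+1`. -/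
def perWord {p : ℕ} (c : Fin (p + 1) → ℚ) : ℕ → ℚ :=
  fun i => c ⟨i % (p + 1), Nat.mod_lt _ (Nat.succ_pos p)⟩

/-- The infinite word `d · w` obtained by prepending a finite word `d` to an
infinite word `w`. -/
def prepend (d : List ℚ) (w : ℕ → ℚ) : ℕ → ℚ :=
  fun i => if h : i < d.length then d.get ⟨i, h⟩ else w (i - d.length)

/-- A cycle `x_0 … x_p` of a transition system. -/
def TS.IsCycle (S : TS X) {p : ℕ} (x : Fin (p + 1) → X) : Prop :=
  (∀ i : Fin p, (x i.castSucc, x i.succ) ∈ S.E) ∧ (x (Fin.last p), x 0) ∈ S.E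

open Filter Topology in
/-- If the values of two sequences differ by a null sequence and the second one is bounded, then
the lower limit of the first is at most that of the second. -/
theorem liminf_le_of_sub_tendsto_zero {a b : ℕ → ℝ} {M : ℝ} (hb : ∀ n, |b n| ≤ M)
    (h : Tendsto (fun n => a n - b n) atTop (𝓝 0)) : liminf a atTop ≤ liminf b atTop := by
  have hle : IsBoundedUnder (· ≤ ·) atTop b := isBoundedUnder_of ⟨M, fun n => (abs_le.1 (hb n)).2⟩
  have hge : IsBoundedUnder (· ≥ ·) atTop b := isBoundedUnder_of ⟨-M, fun n => (abs_le.1 (hb n)).1⟩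
  have key := liminf_add_le h.isBoundedUnder_ge h.isBoundedUnder_le hge hle.isCoboundedUnder_ge
  have hab : (fun n => a n - b n) + b = a := by
    ext n
    simp
  rwa [hab, h.limsup_eq, zero_add] at key

theorem abs_sum_range_le {v : ℕ → ℚ} {M : ℝ} (hv : ∀ i, |(v i : ℝ)| ≤ M) (n : ℕ) :
    |∑ i ∈ Finset.range n, (v i : ℝ)| ≤ n * M := by
  calc |∑ i ∈ Finset.range n, (v i : ℝ)| ≤ ∑ i ∈ Finset.range n, |(v i : ℝ)| :=
        Finset.abs_sum_le_sum_abs _ _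
    _ ≤ ∑ _i ∈ Finset.range n, M := Finset.sum_le_sum fun i _ => hv i
    _ = n * M := by simp

theorem abs_average_le {v : ℕ → ℚ} {M : ℝ} (hv : ∀ i, |(v i : ℝ)| ≤ M) (n : ℕ) :
    |(∑ i ∈ Finset.range (n + 1), (v i : ℝ)) / (n + 1)| ≤ M := by
  have hn : (0 : ℝ) < n + 1 := by positivity
  rw [abs_div, abs_of_pos hn, div_le_iff₀ hn, mul_comm]
  exact_mod_cast abs_sum_range_le hv (n + 1)

open Filter in
theorem neg_le_LimAvg {v : ℕ → ℚ} {M : ℝ} (hv : ∀ i, |(v i : ℝ)| ≤ M) : -M ≤ LimAvg v :=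
  le_liminf_of_le
    (isBoundedUnder_of ⟨M, fun n => (abs_le.1 (abs_average_le hv n)).2⟩).isCoboundedUnder_ge
    (Eventually.of_forall fun n => (abs_le.1 (abs_average_le hv n)).1)

open Filter Topology in
/-- Removing a finite prefix from a bounded sequence does not decrease its limit average. -/
theorem LimAvg_le_LimAvg_shift {v : ℕ → ℚ} {M : ℝ} (hv : ∀ i, |(v i : ℝ)| ≤ M) (k : ℕ) :
    LimAvg v ≤ LimAvg fun i => v (i + k) := by
  have hw : ∀ i, |(v (i + k) : ℝ)| ≤ M := fun i => hv (i + k)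
  unfold LimAvg
  rw [← liminf_nat_add _ k]
  refine liminf_le_of_sub_tendsto_zero (abs_average_le hw) ?_
  have hlim : Tendsto (fun n : ℕ => (2 * k * M) / ((n + 1 + k : ℕ) : ℝ)) atTop (𝓝 0) :=
    (tendsto_const_div_atTop_nhds_zero_nat (2 * k * M)).comp
      ((tendsto_add_atTop_nat k).comp (tendsto_add_atTop_nat 1))
  refine squeeze_zero_norm (fun n => ?_) hlim
  have hsplit : ∑ i ∈ Finset.range (n + k + 1), (v i : ℝ) =
      ∑ i ∈ Finset.range k, (v i : ℝ) + ∑ i ∈ Finset.range (n + 1), (v (i + k) : ℝ) := by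
    rw [show n + k + 1 = k + (n + 1) by ring, Finset.sum_range_add]
    simp only [add_comm k]
  have hpre := abs_sum_range_le hv k
  have havg := abs_average_le hw n
  rw [hsplit]
  generalize ∑ i ∈ Finset.range k, (v i : ℝ) = D at *
  generalize ∑ i ∈ Finset.range (n + 1), (v (i + k) : ℝ) = T at *
  have hn : (0 : ℝ) < n + 1 := by positivity
  have hnk : (0 : ℝ) < n + 1 + k := by positivity
  have hdiff : (D + T) / (((n + k : ℕ) : ℝ) + 1) - T / (n + 1) =
      (D - k * (T / (n + 1))) / (n + 1 + k) := by
    push_cast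
    rw [show (n : ℝ) + k + 1 = n + 1 + k by ring]
    field_simp
    ring
  rw [hdiff, Real.norm_eq_abs, abs_div, abs_of_pos hnk]
  push_cast
  gcongr
  calc |D - k * (T / (n + 1))| ≤ |D| + |k * (T / (n + 1))| := abs_sub _ _
    _ = |D| + k * |T / (n + 1)| := by rw [abs_mul, Nat.abs_cast]
    _ ≤ k * M + k * M := by gcongr
    _ = 2 * k * M := by ring

theorem prepend_add_length (d : List ℚ) (w : ℕ → ℚ) :
    (fun i => prepend d w (i + d.length)) = w := by
  ext i
  simp [prepend]

theorem TS.exists_abs_le_of_mem_Beh {S : TS X} {Y : Finset ℚ} (hY : ∀ x, S.H x ∈ Y) :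
    ∃ M : ℝ, ∀ b ∈ S.Beh, ∀ i, |(b i : ℝ)| ≤ M := by
  refine ⟨∑ y ∈ Y, |(y : ℝ)|, ?_⟩
  rintro b ⟨r, -, rfl⟩ i
  exact Finset.single_le_sum (f := fun y : ℚ => |(y : ℝ)|) (fun _ _ => abs_nonneg _) (hY (r i))

theorem TS.bddBelow_LimAvg_image_Beh {S : TS X} {Y : Finset ℚ}
    (hY : ∀ x, S.H x ∈ Y) : BddBelow (LimAvg '' S.Beh) := by
  obtain ⟨M, hM⟩ := TS.exists_abs_le_of_mem_Beh hY
  refine ⟨-M, ?_⟩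
  rintro _ ⟨b, hb, rfl⟩
  exact neg_le_LimAvg (hM b hb)

/-- if `B^ω(S_a) ⊆ B^ω(S_b)`, `S_b` has a cycle with output word
`c` satisfying `LimAvg(c^ω) = VS(S_b)`, and `d c^ω ∈ B^ω(S_a)` for some finite
word `d`, then `VS(S_a) = VS(S_b)`. -/
theorem stmt1 {Xa Xb : Type*} (Y : Finset ℚ) (Sa : TS Xa) (Sb : TS Xb)
    (hYa : ∀ x, Sa.H x ∈ Y) (hYb : ∀ x, Sb.H x ∈ Y)
    (hsub : Sa.Beh ⊆ Sb.Beh)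
    (p : ℕ) (x : Fin (p + 1) → Xb) (hcyc : Sb.IsCycle x)
    (hmin : LimAvg (perWord fun i => Sb.H (x i)) = Sb.VS)
    (d : List ℚ)
    (hd : prepend d (perWord fun i => Sb.H (x i)) ∈ Sa.Beh) :
    Sa.VS = Sb.VS := by
  apply le_antisymm
  · obtain ⟨M, hM⟩ := TS.exists_abs_le_of_mem_Beh hYa
    have hshift := LimAvg_le_LimAvg_shift (hM _ hd) d.length
    rw [prepend_add_length, hmin] at hshift
    exact (csInf_le (TS.bddBelow_LimAvg_image_Beh hYa) (Set.mem_image_of_mem _ hd)).trans hshift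
  · exact csInf_le_csInf (TS.bddBelow_LimAvg_image_Beh hYb) (Set.Nonempty.image _ ⟨_, hd⟩)
      (Set.image_mono hsub)
end

section
/- Let S_a = (X_a, X_a, E_a, Y, H_a) and S_b = (X_b, X_b, E_b, Y, H_b) be non-blocking simple weighted transition systems (all states initial) over the same finite output set Y ⊆ ℚ, let R ⊆ X_a × X_b be a simulation relation from S_a to S_b, and let A ⊆ X_b be a strongly forward invariant set of S_b. If there exist x_b ∈ A and x_a ∈ X_a with (x_a, x_b) ∈ R, then VS(S_a) ≤ VL((A, A, E_b ∩ (A × A), Y, H_b)) ≤ VL(S_b). -/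
variable {X : Type*}

noncomputable def TS.VL (S : TS X) : ℝ := sSup (LimAvg '' S.Beh)

/-- A non-blocking transition system: every state has an outgoing transition. -/
def TS.NonBlocking (S : TS X) : Prop := ∀ x, ∃ x', (x, x') ∈ S.E

/-- `R` is a simulation relation from `S_a` to `S_b`. -/
def IsSimulation {Xa Xb : Type*} (Sa : TS Xa) (Sb : TS Xb) (R : Set (Xa × Xb)) : Prop :=
  (∀ xa ∈ Sa.init, ∃ xb ∈ Sb.init, (xa, xb) ∈ R) ∧
  (∀ p ∈ R, Sa.H p.1 = Sb.H p.2) ∧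
  (∀ p ∈ R, ∀ xa', (p.1, xa') ∈ Sa.E → ∃ xb', (p.2, xb') ∈ Sb.E ∧ (xa', xb') ∈ R)

/-- A strongly forward invariant set. -/
def TS.StronglyInvariant (S : TS X) (A : Set X) : Prop :=
  ∀ x ∈ A, ∀ x', (x, x') ∈ S.E → x' ∈ A

/-- The transition system `(A, A, E ∩ (A × A), Y, H)` obtained by restricting
the states to `A` (all restricted states initial). -/
def TS.restrict (S : TS X) (A : Set X) : TS A where
  init := Set.univ
  E := {p | (p.1.1, p.2.1) ∈ S.E}
  H := fun a => S.H a.1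

theorem exists_abs_limAvg_le (Y : Finset ℚ) :
    ∃ M : ℝ, ∀ v : ℕ → ℚ, (∀ i, v i ∈ Y) → |LimAvg v| ≤ M := by
  refine ⟨∑ y ∈ Y, |(y : ℝ)|, fun v hv => ?_⟩
  set M : ℝ := ∑ y ∈ Y, |(y : ℝ)|
  have hM : ∀ i, |(v i : ℝ)| ≤ M := fun i =>
    Finset.single_le_sum (f := fun y : ℚ => |(y : ℝ)|) (fun _ _ => abs_nonneg _) (hv i)
  have havg : ∀ n : ℕ, |(∑ i ∈ Finset.range (n + 1), (v i : ℝ)) / (n + 1)| ≤ M := fun n => by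
    have hn : (0 : ℝ) < n + 1 := by positivity
    rw [abs_div, abs_of_pos hn, div_le_iff₀ hn]
    calc |∑ i ∈ Finset.range (n + 1), (v i : ℝ)|
        ≤ ∑ i ∈ Finset.range (n + 1), |(v i : ℝ)| := Finset.abs_sum_le_sum_abs _ _
      _ ≤ ∑ _i ∈ Finset.range (n + 1), M := Finset.sum_le_sum fun i _ => hM i
      _ = M * (n + 1) := by simp [mul_comm]
  have hlower := fun n => (abs_le.mp (havg n)).1
  have hupper := fun n => (abs_le.mp (havg n)).2
  rw [abs_le]
  constructor
  · exact Filter.le_liminf_of_le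
      (Filter.isBoundedUnder_of ⟨M, hupper⟩).isCoboundedUnder_ge
      (Filter.Eventually.of_forall hlower)
  · exact Filter.liminf_le_of_frequently_le
      (Filter.Eventually.of_forall hupper).frequently
      (Filter.isBoundedUnder_of ⟨-M, hlower⟩)

theorem TS.exists_abs_le_of_mem_limAvg_beh (S : TS X) (Y : Finset ℚ) (hY : ∀ x, S.H x ∈ Y) :
    ∃ M : ℝ, ∀ a ∈ LimAvg '' S.Beh, |a| ≤ M := by
  obtain ⟨M, hM⟩ := exists_abs_limAvg_le Y
  refine ⟨M, ?_⟩
  rintro _ ⟨_, ⟨r, -, rfl⟩, rfl⟩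
  exact hM _ fun i => hY _

theorem TS.bddAbove_limAvg_beh (S : TS X) (Y : Finset ℚ) (hY : ∀ x, S.H x ∈ Y) :
    BddAbove (LimAvg '' S.Beh) :=
  let ⟨M, hM⟩ := S.exists_abs_le_of_mem_limAvg_beh Y hY
  ⟨M, fun a ha => (abs_le.mp (hM a ha)).2⟩

theorem TS.bddBelow_limAvg_beh (S : TS X) (Y : Finset ℚ) (hY : ∀ x, S.H x ∈ Y) :
    BddBelow (LimAvg '' S.Beh) :=
  let ⟨M, hM⟩ := S.exists_abs_le_of_mem_limAvg_beh Y hY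
  ⟨-M, fun a ha => (abs_le.mp (hM a ha)).1⟩

/-- Restricting to a set of states of a system whose states are all initial only removes traces. -/
theorem TS.beh_restrict_subset (S : TS X) (hI : S.init = Set.univ) (A : Set X) :
    (S.restrict A).Beh ⊆ S.Beh := by
  rintro _ ⟨r, hr, rfl⟩
  exact ⟨fun i => (r i).1, ⟨hI ▸ Set.mem_univ _, hr.2⟩, rfl⟩

/-- A run of a non-blocking system, matched step by step through a simulation starting from a
state of an invariant set, yields a trace common to it and to the restricted system. -/
theorem IsSimulation.exists_mem_beh_restrict {Xa Xb : Type*} {Sa : TS Xa} {Sb : TS Xb}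
    {R : Set (Xa × Xb)} (hR : IsSimulation Sa Sb R) (hnba : Sa.NonBlocking)
    {A : Set Xb} (hA : Sb.StronglyInvariant A)
    {xa : Xa} {xb : Xb} (hxa : xa ∈ Sa.init) (hxb : xb ∈ A) (hrel : (xa, xb) ∈ R) :
    ∃ b ∈ Sa.Beh, b ∈ (Sb.restrict A).Beh := by
  have hstep : ∀ p : {p : Xa × Xb // p ∈ R ∧ p.2 ∈ A}, ∃ q : {p : Xa × Xb // p ∈ R ∧ p.2 ∈ A},
      (p.1.1, q.1.1) ∈ Sa.E ∧ (p.1.2, q.1.2) ∈ Sb.E := by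
    rintro ⟨p, hpR, hpA⟩
    obtain ⟨xa', hEa⟩ := hnba p.1
    obtain ⟨xb', hEb, hR'⟩ := hR.2.2 p hpR xa' hEa
    exact ⟨⟨(xa', xb'), hR', hA _ hpA _ hEb⟩, hEa, hEb⟩
  choose f hfa hfb using hstep
  let r : ℕ → {p : Xa × Xb // p ∈ R ∧ p.2 ∈ A} := Nat.rec ⟨(xa, xb), hrel, hxb⟩ fun _ => f
  refine ⟨fun i => Sa.H (r i).1.1, ⟨fun i => (r i).1.1, ⟨hxa, fun i => hfa (r i)⟩, rfl⟩,
    fun i => ⟨(r i).1.2, (r i).2.2⟩, ⟨Set.mem_univ _, fun i => hfb (r i)⟩, ?_⟩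
  funext i
  exact hR.2.1 _ (r i).2.1

/-- with a simulation relation `R` from `S_a` to `S_b` and a
strongly forward invariant set `A` of `S_b` containing a state related to some
state of `S_a`, one has `VS(S_a) ≤ VL(S_b restricted to A) ≤ VL(S_b)`. -/
theorem stmt2 {Xa Xb : Type*} (Y : Finset ℚ) (Sa : TS Xa) (Sb : TS Xb)
    (hYa : ∀ x, Sa.H x ∈ Y) (hYb : ∀ x, Sb.H x ∈ Y)
    (hIa : Sa.init = Set.univ) (hIb : Sb.init = Set.univ)
    (hnba : Sa.NonBlocking) (hnbb : Sb.NonBlocking)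
    (R : Set (Xa × Xb)) (hR : IsSimulation Sa Sb R)
    (A : Set Xb) (hA : Sb.StronglyInvariant A)
    (xa : Xa) (xb : Xb) (hxb : xb ∈ A) (hrel : (xa, xb) ∈ R) :
    Sa.VS ≤ (Sb.restrict A).VL ∧ (Sb.restrict A).VL ≤ Sb.VL := by
  obtain ⟨b, hba, hbb⟩ :=
    hR.exists_mem_beh_restrict hnba hA (hIa ▸ Set.mem_univ xa) hxb hrel
  have hbddA := (Sb.restrict A).bddAbove_limAvg_beh Y fun x => hYb x.1
  exact ⟨(csInf_le (Sa.bddBelow_limAvg_beh Y hYa) (Set.mem_image_of_mem _ hba)).trans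
      (le_csSup hbddA (Set.mem_image_of_mem _ hbb)),
    csSup_le_csSup (Sb.bddAbove_limAvg_beh Y hYb) ⟨_, Set.mem_image_of_mem _ hbb⟩
      (Set.image_mono (Sb.beh_restrict_subset hIb A))⟩
end

section
/- Consider the PETC traffic system S determined by matrices M(1), …, M(k̄) and symmetric matrices N(1), …, N(k̄−1), and let σ = k_1…k_m be a word over Y = {1,…,k̄}. If M_σ is nonsingular and there exists a linear subspace A ⊆ ℝ^n with A ≠ {0}, M_σ A = A, and A \ {0} ⊆ Q_σ, then σ^ω ∈ B^ω(S), i.e., some x ∈ ℝ^n has inter-sample-time trace equal to the periodic word σ^ω. -/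
open Matrix

variable {n : ℕ}

/-- The triggering map `κ(x) = min{k ∈ {1,…,k̄} : xᵀN(k)x > 0 or k = k̄}`. -/
noncomputable def kappa (N : ℕ → Matrix (Fin n) (Fin n) ℝ) (kbar : ℕ)
    (x : Fin n → ℝ) : ℕ :=
  sInf {k : ℕ | 1 ≤ k ∧ (k = kbar ∨ 0 < x ⬝ᵥ (N k).mulVec x)}

/-- The sampled-state trajectory of the PETC traffic system:
`x_0 = x`, `x_{i+1} = M(κ(x_i)) x_i`. -/
noncomputable def traj (M N : ℕ → Matrix (Fin n) (Fin n) ℝ) (kbar : ℕ)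
    (x : Fin n → ℝ) : ℕ → (Fin n → ℝ)
  | 0 => x
  | i + 1 => (M (kappa N kbar (traj M N kbar x i))).mulVec (traj M N kbar x i)

/-- The inter-sample-time trace generated by the initial state `x`. -/
noncomputable def petcTrace (M N : ℕ → Matrix (Fin n) (Fin n) ℝ) (kbar : ℕ)
    (x : Fin n → ℝ) : ℕ → ℕ :=
  fun i => kappa N kbar (traj M N kbar x i)

/-- Product of the first `j` matrices of the word:
`prefProd σ j = M(k_j) ⋯ M(k_2) M(k_1)` (identity for `j = 0`). -/
noncomputable def prefProd (M : ℕ → Matrix (Fin n) (Fin n) ℝ) {m : ℕ}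
    (σ : Fin m → ℕ) (j : ℕ) : Matrix (Fin n) (Fin n) ℝ :=
  ((((List.ofFn σ).take j).reverse).map M).prod

/-- `M_σ = M(k_m) ⋯ M(k_1)`. -/
noncomputable def Msigma (M : ℕ → Matrix (Fin n) (Fin n) ℝ) {m : ℕ}
    (σ : Fin m → ℕ) : Matrix (Fin n) (Fin n) ℝ :=
  prefProd M σ m

/-- The `σ`-cone `Q_σ`: the set of states whose next `m` inter-sample times
are exactly `σ`. -/
noncomputable def Qsigma (M N : ℕ → Matrix (Fin n) (Fin n) ℝ) (kbar : ℕ)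
    {m : ℕ} (σ : Fin m → ℕ) : Set (Fin n → ℝ) :=
  {x | ∀ i : Fin m, kappa N kbar ((prefProd M σ i).mulVec x) = σ i}

/-- `σ^ω ∈ B^ω(S)`: some state generates the periodic trace `σ^ω`. -/
noncomputable def PerTraceMem (M N : ℕ → Matrix (Fin n) (Fin n) ℝ) (kbar : ℕ)
    {m : ℕ} (hm : 0 < m) (σ : Fin m → ℕ) : Prop :=
  ∃ x : Fin n → ℝ, ∀ i : ℕ,
    petcTrace M N kbar x i = σ ⟨i % m, Nat.mod_lt _ hm⟩

theorem prefProd_zero (M : ℕ → Matrix (Fin n) (Fin n) ℝ) {m : ℕ} (σ : Fin m → ℕ) :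
    prefProd M σ 0 = 1 := by
  simp [prefProd]

theorem prefProd_succ (M : ℕ → Matrix (Fin n) (Fin n) ℝ) {m : ℕ} (σ : Fin m → ℕ) (i : Fin m) :
    prefProd M σ (i + 1) = M (σ i) * prefProd M σ i := by
  simp [prefProd, List.take_add_one]

/-- If a set is invariant under `M_σ` and contained in the `σ`-cone, every trajectory starting in
it consists of partial products along `σ` applied to points of the set. -/
theorem exists_traj_eq_prefProd_mulVec (M N : ℕ → Matrix (Fin n) (Fin n) ℝ) (kbar : ℕ) {m : ℕ}
    (hm : 0 < m) (σ : Fin m → ℕ) {S : Set (Fin n → ℝ)} (hS : S ⊆ Qsigma M N kbar σ)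
    (hinv : ∀ y ∈ S, (Msigma M σ).mulVec y ∈ S) {x : Fin n → ℝ} (hx : x ∈ S) (i : ℕ) :
    ∃ y ∈ S, traj M N kbar x i = (prefProd M σ (i % m)).mulVec y := by
  induction i with
  | zero => exact ⟨x, hx, by simp [traj, prefProd_zero]⟩
  | succ i ih =>
    obtain ⟨y, hy, hxy⟩ := ih
    have hstep : traj M N kbar x (i + 1) = (prefProd M σ (i % m + 1)).mulVec y := by
      have hk := hS hy ⟨i % m, Nat.mod_lt _ hm⟩
      have hp := prefProd_succ M σ ⟨i % m, Nat.mod_lt _ hm⟩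
      simp only at hk hp
      rw [traj, hxy, hk, hp, mulVec_mulVec]
    rcases (Nat.succ_le_of_lt (Nat.mod_lt i hm)).lt_or_eq with hlt | heq
    · refine ⟨y, hy, ?_⟩
      rw [hstep, ← Nat.mod_add_mod, Nat.mod_eq_of_lt hlt]
    · refine ⟨(Msigma M σ).mulVec y, hinv y hy, ?_⟩
      rw [hstep, ← Nat.mod_add_mod i m 1, show i % m + 1 = m from heq, Nat.mod_self,
        prefProd_zero, one_mulVec, Msigma]

/-- if `M_σ` is nonsingular and some nontrivial linear invariant
subspace `A` of `M_σ` satisfies `A \ {0} ⊆ Q_σ`, then `σ^ω ∈ B^ω(S)`. -/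
theorem stmt6 (n kbar : ℕ) (hkbar : 1 ≤ kbar)
    (M N : ℕ → Matrix (Fin n) (Fin n) ℝ)
    (hNsymm : ∀ k, 1 ≤ k → k < kbar → (N k).IsSymm)
    (m : ℕ) (hm : 0 < m) (σ : Fin m → ℕ)
    (hσY : ∀ i, 1 ≤ σ i ∧ σ i ≤ kbar)
    (hdet : (Msigma M σ).det ≠ 0)
    (A : Submodule ℝ (Fin n → ℝ)) (hA : A ≠ ⊥)
    (hAinv : A.map (Msigma M σ).mulVecLin = A)
    (hAsub : (A : Set (Fin n → ℝ)) \ {0} ⊆ Qsigma M N kbar σ) :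
    PerTraceMem M N kbar hm σ := by
  obtain ⟨x, hxA, hx0⟩ := A.ne_bot_iff.mp hA
  have hinv : ∀ y ∈ (A : Set (Fin n → ℝ)) \ {0},
      (Msigma M σ).mulVec y ∈ (A : Set (Fin n → ℝ)) \ {0} := by
    rintro y ⟨hyA, hy0⟩
    refine ⟨?_, fun h => hy0 (eq_zero_of_mulVec_eq_zero hdet h)⟩
    have h := Submodule.mem_map_of_mem (f := (Msigma M σ).mulVecLin) hyA
    rw [hAinv] at h
    exact h
  refine ⟨x, fun i => ?_⟩
  obtain ⟨y, hy, hxy⟩ :=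
    exists_traj_eq_prefProd_mulVec M N kbar hm σ hAsub hinv ⟨hxA, hx0⟩ i
  rw [petcTrace, hxy]
  exact hAsub hy ⟨i % m, Nat.mod_lt _ hm⟩
end

section
/- Let σ and σ' be words of length n over an alphabet Y that are cyclic permutations of each other with σ ≠ σ'. Then the concatenation σσ' (of length 2n) contains a contiguous subword (infix) of length n that is not a cyclic permutation of σ. -/
/-- Two lists all of whose prefixes of equal length are permutations of each other are equal. -/
theorem List.eq_of_forall_take_perm {α : Type*} {l l' : List α}
    (hlen : l.length = l'.length) (h : ∀ i, (l.take i).Perm (l'.take i)) : l = l' := by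
  induction l generalizing l' with
  | nil => exact (List.length_eq_zero_iff.mp hlen.symm).symm
  | cons a t ih =>
    cases l' with
    | nil => simp at hlen
    | cons b t' =>
      obtain rfl : a = b := by simpa using h 1
      rw [ih (by simpa using hlen) fun i => by simpa using h (i + 1)]

/-- if `σ` and `σ'` are distinct cyclic permutations (rotations)
of each other, both of length `n`, then the concatenation `σ ++ σ'` contains a
length-`n` infix that is not a cyclic permutation of `σ`. -/
theorem stmt13 {Y : Type*} (n : ℕ) (σ σ' : List Y)
    (hlen : σ.length = n) (hrot : σ ~r σ') (hne : σ ≠ σ') :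
    ∃ β : List Y, β.length = n ∧ β <:+: σ ++ σ' ∧ ¬ (σ ~r β) := by
  by_contra! hall
  have hlen' : σ.length = σ'.length := hrot.perm.length_eq
  refine hne (List.eq_of_forall_take_perm hlen' fun i => ?_)
  rcases le_total i n with hi | hi
  · have hwindow : σ ~r σ.drop i ++ σ'.take i := by
      refine hall _ (by simp; omega) ⟨σ.take i, σ'.drop i, ?_⟩
      rw [← List.append_assoc, List.take_append_drop, List.append_assoc, List.take_append_drop]
    have hperm : (σ.drop i ++ σ.take i).Perm (σ.drop i ++ σ'.take i) :=
      (List.perm_append_comm.trans (by rw [List.take_append_drop])).trans hwindow.perm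
    exact (List.perm_append_left_iff _).mp hperm
  · rw [List.take_of_length_le (by omega), List.take_of_length_le (by omega)]
    exact hrot.perm
end
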